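/- Let ω be any 3-form on ℝ^8. Then the reduced trace form is compatible with the reduced multiplication: b^ω(a·b, c) = b^ω(a, b·c) for all a, b, c ∈ ℝ^8. -/

import Mathlib

noncomputable section

/-- The wedge product of real-valued alternating forms (via `AlternatingMap.domCoprod`). -/
def awedge {V : Type*} [AddCommGroup V] [Module ℝ V] {p q : ℕ}
    (α : V [⋀^Fin p]→ₗ[ℝ] ℝ) (β : V [⋀^Fin q]→ₗ[ℝ] ℝ) : V [⋀^Fin (p + q)]→ₗ[ℝ] ℝ :=
  ((TensorProduct.lid ℝ ℝ).toLinearMap.compAlternatingMap (α.domCoprod β)).domDomCongr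
    finSumFinEquiv

/-- The standard volume form `θ = e^1 ∧ ⋯ ∧ e^8` on `ℝ⁸`: the determinant form on the
standard basis. -/
def volForm : (Fin 8 → ℝ) [⋀^Fin 8]→ₗ[ℝ] ℝ := Matrix.detRowAlternating

/-- `mul` is the reduced multiplication of the 3-form `ω`: for all `v, w`, the vector
`v·w = mul v w` satisfies `(v·w) ⌟ θ = (v ⌟ ω) ∧ (w ⌟ ω) ∧ ω`, where `⌟` is insertion in
the first slot. -/
def IsReducedMul (ω : (Fin 8 → ℝ) [⋀^Fin 3]→ₗ[ℝ] ℝ)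
    (mul : (Fin 8 → ℝ) →ₗ[ℝ] (Fin 8 → ℝ) →ₗ[ℝ] (Fin 8 → ℝ)) : Prop :=
  ∀ v w : Fin 8 → ℝ,
    volForm.curryLeft (mul v w) = awedge (awedge (ω.curryLeft v) (ω.curryLeft w)) ω

/-- The reduced trace form `b^ω(v,w) = Tr (L_v ∘ L_w)`, where `L_v(w) = v·w = mul v w`. -/
def reducedTraceForm (mul : (Fin 8 → ℝ) →ₗ[ℝ] (Fin 8 → ℝ) →ₗ[ℝ] (Fin 8 → ℝ))
    (v w : Fin 8 → ℝ) : ℝ :=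
  LinearMap.trace ℝ (Fin 8 → ℝ) (mul v ∘ₗ mul w)

theorem awedge_eq {V : Type*} [AddCommGroup V] [Module ℝ V] {p q : ℕ}
    (α : V [⋀^Fin p]→ₗ[ℝ] ℝ) (β : V [⋀^Fin q]→ₗ[ℝ] ℝ) :
    awedge α β = ((TensorProduct.lid ℝ ℝ).toLinearMap.compAlternatingMap
      (AlternatingMap.domCoprod' (TensorProduct.tmul ℝ α β))).domDomCongr finSumFinEquiv :=
  rfl

section Wedge

theorem altMap_sum_apply {V ι κ : Type*} [AddCommGroup V] [Module ℝ V] (s : Finset κ)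
    (f : κ → V [⋀^ι]→ₗ[ℝ] ℝ) (v : ι → V) : (∑ k ∈ s, f k) v = ∑ k ∈ s, f k v := by
  classical
  induction s using Finset.induction_on with
  | empty => simp
  | insert a s ha ih => simp [Finset.sum_insert ha, ih]

variable {V W : Type*} [AddCommGroup V] [Module ℝ V] [AddCommGroup W] [Module ℝ W] {p q : ℕ}

theorem awedge_add_left (α α' : V [⋀^Fin p]→ₗ[ℝ] ℝ) (β : V [⋀^Fin q]→ₗ[ℝ] ℝ) :
    awedge (α + α') β = awedge α β + awedge α' β := by
  ext v
  simp [awedge_eq, TensorProduct.add_tmul, -AlternatingMap.domCoprod'_apply]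

theorem awedge_add_right (α : V [⋀^Fin p]→ₗ[ℝ] ℝ) (β β' : V [⋀^Fin q]→ₗ[ℝ] ℝ) :
    awedge α (β + β') = awedge α β + awedge α β' := by
  ext v
  simp [awedge_eq, TensorProduct.tmul_add, -AlternatingMap.domCoprod'_apply]

theorem awedge_smul_left (c : ℝ) (α : V [⋀^Fin p]→ₗ[ℝ] ℝ) (β : V [⋀^Fin q]→ₗ[ℝ] ℝ) :
    awedge (c • α) β = c • awedge α β := by
  ext v
  simp [awedge_eq, ← TensorProduct.smul_tmul', -AlternatingMap.domCoprod'_apply]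

theorem awedge_smul_right (c : ℝ) (α : V [⋀^Fin p]→ₗ[ℝ] ℝ) (β : V [⋀^Fin q]→ₗ[ℝ] ℝ) :
    awedge α (c • β) = c • awedge α β := by
  ext v
  simp [awedge_eq, -AlternatingMap.domCoprod'_apply]

/-- The wedge product as a bilinear map. -/
def wedgeLin (V : Type*) [AddCommGroup V] [Module ℝ V] (p q : ℕ) :
    (V [⋀^Fin p]→ₗ[ℝ] ℝ) →ₗ[ℝ] (V [⋀^Fin q]→ₗ[ℝ] ℝ) →ₗ[ℝ] (V [⋀^Fin (p + q)]→ₗ[ℝ] ℝ) :=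
  LinearMap.mk₂ ℝ awedge awedge_add_left awedge_smul_left awedge_add_right awedge_smul_right

theorem awedge_compLinearMap (g : W →ₗ[ℝ] V) (α : V [⋀^Fin p]→ₗ[ℝ] ℝ)
    (β : V [⋀^Fin q]→ₗ[ℝ] ℝ) :
    awedge (α.compLinearMap g) (β.compLinearMap g) = (awedge α β).compLinearMap g := by
  ext v
  simp only [awedge, AlternatingMap.domDomCongr_apply, LinearMap.compAlternatingMap_apply,
    AlternatingMap.compLinearMap_apply, AlternatingMap.domCoprod_apply, sum_apply]
  congr 1
  refine Finset.sum_congr rfl fun σ _ => ?_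
  induction σ using Quotient.inductionOn'
  rfl

end Wedge

/-- The decomposable form `e^{s 0} ∧ ⋯ ∧ e^{s (n-1)}` on `ℝ⁸`. -/
def decForm {n : ℕ} (s : Fin n → Fin 8) : (Fin 8 → ℝ) [⋀^Fin n]→ₗ[ℝ] ℝ :=
  Matrix.detRowAlternating.compLinearMap (LinearMap.funLeft ℝ ℝ s)

theorem decForm_apply {n : ℕ} (s : Fin n → Fin 8) (v : Fin n → Fin 8 → ℝ) :
    decForm s v = (Matrix.of fun i j => v i (s j)).det :=
  rfl

theorem decForm_eq_alternatization {n : ℕ} (s : Fin n → Fin 8) :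
    decForm s = MultilinearMap.alternatization
      ((MultilinearMap.mkPiAlgebra ℝ (Fin n) ℝ).compLinearMap
        fun i => LinearMap.proj (s i)) := by
  ext v
  rw [decForm_apply, Matrix.det_apply, MultilinearMap.alternatization_apply]
  rfl

theorem awedge_decForm {p q : ℕ} (s : Fin p → Fin 8) (t : Fin q → Fin 8) :
    awedge (decForm s) (decForm t) = decForm (Fin.append s t) := by
  ext v
  rw [awedge, decForm_eq_alternatization, decForm_eq_alternatization,
    ← MultilinearMap.domCoprod_alternization]
  simp only [AlternatingMap.domDomCongr_apply, LinearMap.compAlternatingMap_apply,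
    MultilinearMap.alternatization_apply, map_sum, decForm_apply, Matrix.det_apply]
  refine Fintype.sum_equiv finSumFinEquiv.permCongr _ _ fun σ => ?_
  rcases Int.units_eq_one_or σ.sign with h | h <;>
    simp [h, Fin.prod_univ_add, Equiv.permCongr_apply]

theorem decForm_curryLeft {n : ℕ} (s : Fin (n + 1) → Fin 8) (v : Fin 8 → ℝ) :
    (decForm s).curryLeft v =
      ∑ l : Fin (n + 1), ((-1) ^ (l : ℕ) * v (s l)) • decForm (s ∘ l.succAbove) := by
  ext w
  rw [AlternatingMap.curryLeft_apply_apply, decForm_apply, Matrix.det_succ_row_zero,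
    altMap_sum_apply]
  rfl

/-- The standard basis vector of `ℝ⁸`. -/
abbrev stdVec (i : Fin 8) : Fin 8 → ℝ := Pi.single i 1

/-- The standard basis of `ℝ⁸` with the `k`-th vector removed. -/
abbrev omitVec (k : Fin 8) : Fin 7 → Fin 8 → ℝ := fun a => stdVec (k.succAbove a)

theorem sevenForm_ext {η η' : (Fin 8 → ℝ) [⋀^Fin 7]→ₗ[ℝ] ℝ}
    (h : ∀ k, η (omitVec k) = η' (omitVec k)) : η = η' := by
  refine Module.Basis.ext_alternating (Pi.basisFun ℝ (Fin 8)) fun v hv => ?_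
  obtain ⟨k, hk⟩ : ∃ k, ∀ a, v a ≠ k := by
    by_contra! hc
    have := Fintype.card_le_of_surjective v hc
    simp at this
  choose f hf using fun a => Fin.exists_succAbove_eq (hk a)
  have hinj : Function.Injective f := fun a b hab => hv (by rw [← hf a, ← hf b, hab])
  let σ : Equiv.Perm (Fin 7) := Equiv.ofBijective f (Finite.injective_iff_bijective.1 hinj)
  have hσ : (fun a => Pi.basisFun ℝ (Fin 8) (v a)) = omitVec k ∘ σ := by
    funext a
    simp [σ, ← hf a]
  rw [hσ, AlternatingMap.map_perm, AlternatingMap.map_perm, h]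

theorem decForm_omitVec (k l : Fin 8) :
    decForm l.succAbove (omitVec k) = if l = k then 1 else 0 := by
  rw [decForm_apply]
  split_ifs with h
  · subst h
    convert! Matrix.det_one (n := Fin 7) (R := ℝ)
    ext a b
    simp [Matrix.one_apply, Pi.single_apply, eq_comm]
  · obtain ⟨a, ha⟩ := Fin.exists_succAbove_eq h
    refine Matrix.det_eq_zero_of_row_eq_zero a fun b => ?_
    simp [ha, Pi.single_apply]

theorem detRowAlternating_eq_det_of {n : ℕ} (v : Fin n → Fin n → ℝ) :
    Matrix.detRowAlternating v = (Matrix.of v).det :=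
  rfl

theorem volForm_apply (v : Fin 8 → Fin 8 → ℝ) : volForm v = (Matrix.of v).det := by
  rw [volForm, detRowAlternating_eq_det_of]

theorem volForm_curryLeft_omitVec (u : Fin 8 → ℝ) (k : Fin 8) :
    volForm.curryLeft u (omitVec k) = (-1) ^ (k : ℕ) * u k := by
  rw [AlternatingMap.curryLeft_apply_apply, volForm_apply, Matrix.det_succ_row_zero,
    Finset.sum_eq_single k]
  · have h := decForm_omitVec k k
    rw [if_pos rfl, decForm_apply] at h
    convert! mul_one _ using 2
  · intro l _ hl
    have h := decForm_omitVec k l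
    rw [if_neg hl, decForm_apply] at h
    convert! mul_zero _ using 2
  · simp

/-- The reduced multiplication of a 3-form on `ℝ⁸`, in coordinates. -/
def redMul (ω : (Fin 8 → ℝ) [⋀^Fin 3]→ₗ[ℝ] ℝ) :
    (Fin 8 → ℝ) →ₗ[ℝ] (Fin 8 → ℝ) →ₗ[ℝ] (Fin 8 → ℝ) :=
  LinearMap.mk₂ ℝ
    (fun v w k => (-1) ^ (k : ℕ) *
      awedge (awedge (ω.curryLeft v) (ω.curryLeft w)) ω (omitVec k))
    (fun v v' w => by
      ext k
      simp [awedge_add_left, mul_add])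
    (fun c v w => by
      ext k
      simp [awedge_smul_left, mul_left_comm])
    (fun v w w' => by
      ext k
      simp [awedge_add_left, awedge_add_right, mul_add])
    (fun c v w => by
      ext k
      simp [awedge_smul_left, awedge_smul_right, mul_left_comm])

theorem redMul_apply (ω : (Fin 8 → ℝ) [⋀^Fin 3]→ₗ[ℝ] ℝ) (v w : Fin 8 → ℝ) (k : Fin 8) :
    redMul ω v w k = (-1) ^ (k : ℕ) *
      awedge (awedge (ω.curryLeft v) (ω.curryLeft w)) ω (omitVec k) := by
  rw [redMul, LinearMap.mk₂_apply]

theorem isReducedMul_iff_eq_redMul {ω : (Fin 8 → ℝ) [⋀^Fin 3]→ₗ[ℝ] ℝ}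
    {mul : (Fin 8 → ℝ) →ₗ[ℝ] (Fin 8 → ℝ) →ₗ[ℝ] (Fin 8 → ℝ)} :
    IsReducedMul ω mul ↔ mul = redMul ω := by
  have hsq (k : ℕ) : (-1 : ℝ) ^ k * (-1) ^ k = 1 := by rw [← mul_pow]; simp
  constructor
  · intro h
    refine LinearMap.ext fun v => LinearMap.ext fun w => funext fun k => ?_
    rw [redMul_apply, ← h v w, volForm_curryLeft_omitVec, ← mul_assoc, hsq, one_mul]
  · rintro rfl v w
    refine sevenForm_ext fun k => ?_
    rw [volForm_curryLeft_omitVec, redMul_apply, ← mul_assoc, hsq, one_mul]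

theorem detRowAlternating_compLinearMap {n : ℕ} (g : (Fin n → ℝ) →ₗ[ℝ] (Fin n → ℝ)) :
    (Matrix.detRowAlternating (R := ℝ)).compLinearMap g =
      LinearMap.det g • Matrix.detRowAlternating := by
  ext v
  have h := Module.Basis.det_comp (Pi.basisFun ℝ (Fin n)) g v
  rw [Pi.basisFun_det] at h
  exact h

theorem volForm_compLinearMap (g : (Fin 8 → ℝ) →ₗ[ℝ] (Fin 8 → ℝ)) :
    volForm.compLinearMap g = LinearMap.det g • volForm := by
  rw [volForm, detRowAlternating_compLinearMap]

theorem curryLeft_smul_symm {V : Type*} [AddCommGroup V] [Module ℝ V] {n : ℕ}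
    {θ : V [⋀^Fin (n + 1)]→ₗ[ℝ] ℝ} {g : V ≃ₗ[ℝ] V} {d : ℝ}
    (h : θ.compLinearMap g.toLinearMap = d • θ) (u : V) :
    θ.curryLeft (d • g.symm u) = (θ.curryLeft u).compLinearMap g.toLinearMap := by
  have hu : u = g.toLinearMap (g.symm u) := by simp
  conv_rhs => rw [hu]
  rw [← AlternatingMap.curryLeft_compLinearMap, h, map_smul, AlternatingMap.curryLeft_smul,
    LinearMap.smul_apply]

theorem curryLeft_smul_symm_of_eq (g : (Fin 8 → ℝ) ≃ₗ[ℝ] (Fin 8 → ℝ))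
    {θ : (Fin 8 → ℝ) [⋀^Fin 8]→ₗ[ℝ] ℝ} {d : ℝ}
    (hθ : θ.compLinearMap g.toLinearMap = d • θ) {u : Fin 8 → ℝ}
    {η : (Fin 8 → ℝ) [⋀^Fin 7]→ₗ[ℝ] ℝ} (h : θ.curryLeft u = η) :
    θ.curryLeft (d • g.symm u) = η.compLinearMap g.toLinearMap := by
  rw [← h]
  exact curryLeft_smul_symm (n := 7) hθ u

theorem IsReducedMul.compLinearMap {ω : (Fin 8 → ℝ) [⋀^Fin 3]→ₗ[ℝ] ℝ}
    {mul : (Fin 8 → ℝ) →ₗ[ℝ] (Fin 8 → ℝ) →ₗ[ℝ] (Fin 8 → ℝ)} (h : IsReducedMul ω mul)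
    (g : (Fin 8 → ℝ) ≃ₗ[ℝ] (Fin 8 → ℝ)) :
    IsReducedMul (ω.compLinearMap g.toLinearMap)
      (LinearMap.det g.toLinearMap •
        (mul.compl₁₂ g.toLinearMap g.toLinearMap).compr₂ g.symm.toLinearMap) := by
  intro v w
  have hcurry (u : Fin 8 → ℝ) : (ω.compLinearMap g.toLinearMap).curryLeft u =
      (ω.curryLeft (g u)).compLinearMap g.toLinearMap :=
    AlternatingMap.curryLeft_compLinearMap _ _ _
  rw [hcurry, hcurry, awedge_compLinearMap, awedge_compLinearMap]
  have hm : (LinearMap.det g.toLinearMap •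
        (mul.compl₁₂ g.toLinearMap g.toLinearMap).compr₂ g.symm.toLinearMap) v w =
      LinearMap.det g.toLinearMap • g.symm (mul (g v) (g w)) := rfl
  rw [hm]
  have h1 := h (g v) (g w)
  generalize awedge (awedge (ω.curryLeft (g v)) (ω.curryLeft (g w))) ω = η at h1 ⊢
  generalize mul (g v) (g w) = u at h1 ⊢
  clear hm hcurry
  have h2 := volForm_compLinearMap g.toLinearMap
  generalize volForm = θ at h1 h2 ⊢
  generalize LinearMap.det g.toLinearMap = d at h2 ⊢
  exact curryLeft_smul_symm_of_eq g h2 h1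

/-- Compatibility of the reduced trace form with the multiplication. -/
def TraceFormCompatible (mul : (Fin 8 → ℝ) →ₗ[ℝ] (Fin 8 → ℝ) →ₗ[ℝ] (Fin 8 → ℝ)) : Prop :=
  ∀ a b c, reducedTraceForm mul (mul a b) c = reducedTraceForm mul a (mul b c)

theorem TraceFormCompatible.conj {mul : (Fin 8 → ℝ) →ₗ[ℝ] (Fin 8 → ℝ) →ₗ[ℝ] (Fin 8 → ℝ)}
    (h : TraceFormCompatible mul) (g : (Fin 8 → ℝ) ≃ₗ[ℝ] (Fin 8 → ℝ)) (d : ℝ) :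
    TraceFormCompatible
      (d • (mul.compl₁₂ g.toLinearMap g.toLinearMap).compr₂ g.symm.toLinearMap) := by
  have key (v w : Fin 8 → ℝ) : reducedTraceForm
      (d • (mul.compl₁₂ g.toLinearMap g.toLinearMap).compr₂ g.symm.toLinearMap) v w =
      d ^ 2 * reducedTraceForm mul (g v) (g w) := by
    unfold reducedTraceForm
    rw [← LinearMap.trace_conj' (mul (g v) ∘ₗ mul (g w)) g.symm, ← smul_eq_mul, ← map_smul]
    congr 1
    ext x
    simp [pow_two, LinearEquiv.conj_apply, mul_assoc]
  intro a b c
  rw [key, key]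
  have hl (v w : Fin 8 → ℝ) :
      reducedTraceForm mul (d • v) w = d * reducedTraceForm mul v w := by
    simp [reducedTraceForm, LinearMap.smul_comp]
  have hr (v w : Fin 8 → ℝ) :
      reducedTraceForm mul v (d • w) = d * reducedTraceForm mul v w := by
    simp [reducedTraceForm, LinearMap.comp_smul]
  simp [hl, hr, h (g a) (g b) (g c)]

/-- The monomials `(c, x, y, z)`, standing for `c e^x ∧ e^y ∧ e^z`, of a generic 3-form. -/
def genericTerms : List (ℤ × Fin 8 × Fin 8 × Fin 8) :=
  [(1, 0, 2, 5), (1, 1, 3, 6), (-1, 0, 4, 7), (-1, 1, 4, 7), (1, 2, 3, 4), (1, 5, 6, 7)]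

/-- The 3-form on `ℝ⁸` with the given list of monomials. -/
def termsForm (L : List (ℤ × Fin 8 × Fin 8 × Fin 8)) : (Fin 8 → ℝ) [⋀^Fin 3]→ₗ[ℝ] ℝ :=
  (L.map fun t => (t.1 : ℝ) • decForm ![t.2.1, t.2.2.1, t.2.2.2]).sum

/-- The monomials `c e^x ⊗ e^y ∧ e^z` of the contraction of a 3-form with a vector. -/
def contractTerms (L : List (ℤ × Fin 8 × Fin 8 × Fin 8)) : List (ℤ × Fin 8 × Fin 8 × Fin 8) :=
  L.flatMap fun t =>
    [t, (-t.1, t.2.2.1, t.2.1, t.2.2.2), (t.1, t.2.2.2, t.2.1, t.2.2.1)]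

theorem termsForm_curryLeft (L : List (ℤ × Fin 8 × Fin 8 × Fin 8)) (v : Fin 8 → ℝ) :
    (termsForm L).curryLeft v = ((contractTerms L).map fun t =>
      ((t.1 : ℝ) * v t.2.1) • decForm ![t.2.2.1, t.2.2.2]).sum := by
  induction L with
  | nil => simp [termsForm, contractTerms]
  | cons t L ih =>
    have h0 : termsForm (t :: L) =
        (t.1 : ℝ) • decForm ![t.2.1, t.2.2.1, t.2.2.2] + termsForm L := by
      simp [termsForm]
    have h1 : contractTerms (t :: L) =
        [t, (-t.1, t.2.2.1, t.2.1, t.2.2.2), (t.1, t.2.2.2, t.2.1, t.2.2.1)] ++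
          contractTerms L := by
      simp [contractTerms]
    have e0 : ![t.2.1, t.2.2.1, t.2.2.2] ∘ Fin.succAbove 0 = ![t.2.2.1, t.2.2.2] := by
      ext i; fin_cases i <;> rfl
    have e1 : ![t.2.1, t.2.2.1, t.2.2.2] ∘ Fin.succAbove 1 = ![t.2.1, t.2.2.2] := by
      ext i; fin_cases i <;> rfl
    have e2 : ![t.2.1, t.2.2.1, t.2.2.2] ∘ Fin.succAbove 2 = ![t.2.1, t.2.2.1] := by
      ext i; fin_cases i <;> rfl
    rw [h0, h1, AlternatingMap.curryLeft_add, AlternatingMap.curryLeft_smul,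
      LinearMap.add_apply, LinearMap.smul_apply, ih, decForm_curryLeft, Fin.sum_univ_three,
      e0, e1, e2]
    simp only [List.map_append, List.sum_append, List.map_cons, List.map_nil, List.sum_cons,
      List.sum_nil, smul_add, smul_smul]
    simp [add_assoc, neg_smul (R := ℝ) (M := (Fin 8 → ℝ) [⋀^Fin 2]→ₗ[ℝ] ℝ)]

/-- The Vandermonde product `∏_{i < j} (l_j - l_i)` of a list. -/
def vandermondeProd : List ℕ → ℤ
  | [] => 1
  | a :: l => if a ∈ l then 0 else (l.map fun b : ℕ => (b : ℤ) - a).prod * vandermondeProd l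

theorem vandermondeProd_ofFn {n : ℕ} (v : Fin n → ℕ) :
    vandermondeProd (List.ofFn v) = (Matrix.vandermonde fun i => (v i : ℤ)).det := by
  rw [Matrix.det_vandermonde]
  induction n with
  | zero => simp [vandermondeProd]
  | succ n ih =>
    rw [List.ofFn_succ, vandermondeProd, ih, Fin.prod_univ_succ, Fin.prod_Ioi_zero,
      List.map_ofFn, List.prod_ofFn]
    split_ifs with h
    · obtain ⟨i, hi⟩ := List.mem_ofFn.1 h
      rw [Finset.prod_eq_zero (Finset.mem_univ i) (by simp [hi]), zero_mul]
    · simp [Fin.prod_Ioi_succ]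

theorem det_incidence_mul {n : ℕ} (U : Fin n → Fin n) :
    (Matrix.of fun i j => if U j = i then (1 : ℤ) else 0).det *
      vandermondeProd (List.ofFn fun i : Fin n => (i : ℕ)) =
      vandermondeProd (List.ofFn fun i => (U i : ℕ)) := by
  rw [vandermondeProd_ofFn, vandermondeProd_ofFn, ← Matrix.det_transpose, ← Matrix.det_mul]
  congr 1
  ext i j
  simp [Matrix.mul_apply, Matrix.vandermonde_apply]

theorem decForm_omitVec_eq_det (k : Fin 8) (T : Fin 7 → Fin 8) :
    (-1) ^ (k : ℕ) * decForm T (omitVec k) =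
      (((Matrix.of fun i j => if (Fin.cons k T : Fin 8 → Fin 8) j = i then (1 : ℤ) else 0).det :
        ℤ) : ℝ) := by
  rw [Matrix.det_succ_column_zero, Finset.sum_eq_single k]
  · rw [decForm_apply]
    simp only [Matrix.of_apply, Fin.cons_zero, if_true, mul_one]
    push_cast
    congr 2
    ext a b
    simp [Pi.single_apply]
  · intro i _ hi
    simp [hi.symm]
  · simp

/-- The monomials of the contraction of a 3-form with the `i`-th basis vector. -/
def contractTermsAt (L : List (ℤ × Fin 8 × Fin 8 × Fin 8)) (i : Fin 8) :
    List (ℤ × Fin 8 × Fin 8 × Fin 8) :=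
  (contractTerms L).filter fun t => t.2.1 = i

/-- The monomials of `(e_i ⌟ ω) ∧ (e_j ⌟ ω) ∧ ω` for `ω = termsForm L`. -/
def wedgeTerms (L : List (ℤ × Fin 8 × Fin 8 × Fin 8)) (i j : Fin 8) : List (ℤ × List ℕ) :=
  (contractTermsAt L i).flatMap fun s => (contractTermsAt L j).flatMap fun t => L.map fun u =>
    (s.1 * t.1 * u.1, [s.2.2.1, s.2.2.2, t.2.2.1, t.2.2.2,
      u.2.1, u.2.2.1, u.2.2.2])

/-- The structure constants of the reduced multiplication of `termsForm L`, scaled by the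
Vandermonde product of `0, …, 7`. -/
def scaledConst (L : List (ℤ × Fin 8 × Fin 8 × Fin 8)) (i j k : Fin 8) : ℤ :=
  (((wedgeTerms L i j).filter fun m => m.2.Nodup).map fun m =>
    m.1 * vandermondeProd (k :: m.2)).sum

/-- The nonzero structure constants `(i, j, k)` with `i ≤ j`, indexed by `64 i + 8 j + k`. -/
def structTable : List (ℕ × ℤ) :=
  [(0, 2), (8, 2), (9, -2), (18, 1), (27, -2), (36, 1), (45, 1), (54, -2), (63, 1), (73, -2),
    (82, 2), (91, -1), (100, -1), (109, 2), (118, -1), (127, -1), (159, 3), (166, 3), (169,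
    -3), (229, 3), (240, 3), (312, -3), (313, 3), (372, -3), (379, -3), (442, -3)]

/-- The structure constants of the reduced multiplication of the generic 3-form. -/
def structConst (i j k : Fin 8) : ℤ :=
  (structTable.lookup (64 * min i.val j.val + 8 * max i.val j.val + k.val)).getD 0

theorem scaledConst_genericTerms : ∀ i j k : Fin 8, scaledConst genericTerms i j k =
    125411328000 * structConst i j k := by
  decide +kernel

/-- The nonzero values `(i, j)` with `i ≤ j` of the trace form, indexed by `8 i + j`. -/
def traceTable : List (ℕ × ℤ) :=
  [(0, 20), (9, 20), (1, 10), (21, -30), (30, -30), (39, -30)]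

/-- The matrix of the reduced trace form of the generic 3-form. -/
def traceConst (i j : Fin 8) : ℤ :=
  (traceTable.lookup (8 * min i.val j.val + max i.val j.val)).getD 0

theorem sum_structConst_mul : ∀ i j : Fin 8,
    ∑ a, ∑ b, structConst i b a * structConst j a b = traceConst i j := by
  decide +kernel

theorem sum_structConst_mul_traceConst : ∀ i j l : Fin 8,
    ∑ k, structConst i j k * traceConst k l = ∑ k, structConst j l k * traceConst i k := by
  decide +kernel

theorem awedge_list_sum_left {V ι : Type*} [AddCommGroup V] [Module ℝ V] {p q : ℕ} (A : List ι)
    (f : ι → V [⋀^Fin p]→ₗ[ℝ] ℝ) (β : V [⋀^Fin q]→ₗ[ℝ] ℝ) :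
    awedge (A.map f).sum β = (A.map fun s => awedge (f s) β).sum := by
  have h := map_list_sum ((wedgeLin V p q).flip β) (A.map f)
  rwa [List.map_map] at h

theorem awedge_list_sum_right {V ι : Type*} [AddCommGroup V] [Module ℝ V] {p q : ℕ} (A : List ι)
    (α : V [⋀^Fin p]→ₗ[ℝ] ℝ) (f : ι → V [⋀^Fin q]→ₗ[ℝ] ℝ) :
    awedge α (A.map f).sum = (A.map fun s => awedge α (f s)).sum := by
  have h := map_list_sum (wedgeLin V p q α) (A.map f)
  rwa [List.map_map] at h

theorem altMap_list_sum_apply {V ι κ : Type*} [AddCommGroup V] [Module ℝ V] (A : List κ)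
    (f : κ → V [⋀^ι]→ₗ[ℝ] ℝ) (v : ι → V) :
    (A.map f).sum v = (A.map fun s => f s v).sum := by
  induction A with
  | nil => simp
  | cons a A ih => simp [ih]

theorem list_sum_map_filter {ι M : Type*} [AddCommMonoid M] (A : List ι) (p : ι → Prop)
    [DecidablePred p] (f : ι → M) (h : ∀ x, ¬ p x → f x = 0) :
    ((A.filter fun x => p x).map f).sum = (A.map f).sum := by
  induction A with
  | nil => simp
  | cons a A ih => by_cases ha : p a <;> simp [ha, ih, h a]

theorem list_sum_flatMap {ι M : Type*} [AddCommMonoid M] (A : List ι) (f : ι → List M) :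
    (A.flatMap f).sum = (A.map fun x => (f x).sum).sum := by
  induction A with
  | nil => simp
  | cons a A ih => simp [ih]

theorem vandermondeProd_eq_zero_of_not_nodup :
    ∀ {l : List ℕ}, ¬ l.Nodup → vandermondeProd l = 0
  | [], h => (h List.nodup_nil).elim
  | a :: l, h => by
    rw [vandermondeProd]
    split_ifs with ha
    · rfl
    · rw [vandermondeProd_eq_zero_of_not_nodup (fun hl => h (List.nodup_cons.2 ⟨ha, hl⟩)),
        mul_zero]

theorem decForm_omitVec_eq_vandermondeProd (k a b c d e f g : Fin 8) :
    125411328000 * ((-1) ^ (k : ℕ) * decForm ![a, b, c, d, e, f, g] (omitVec k)) =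
      (vandermondeProd [k, a, b, c, d, e, f, g] : ℝ) := by
  have h := det_incidence_mul (Fin.cons k ![a, b, c, d, e, f, g] : Fin 8 → Fin 8)
  have h1 : vandermondeProd (List.ofFn fun i : Fin 8 => (i : ℕ)) = 125411328000 := by
    decide +kernel
  have h2 : (List.ofFn fun i =>
      ((Fin.cons k ![a, b, c, d, e, f, g] : Fin 8 → Fin 8) i : ℕ)) =
      [(k : ℕ), a, b, c, d, e, f, g] := by
    simp [List.ofFn_succ]
  rw [h1, h2] at h
  rw [decForm_omitVec_eq_det, ← h]
  push_cast
  ring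

theorem awedge_awedge_decForm (a b c d e f g : Fin 8) :
    awedge (awedge (decForm ![a, b]) (decForm ![c, d])) (decForm ![e, f, g]) =
      decForm ![a, b, c, d, e, f, g] := by
  have h : Fin.append (Fin.append ![a, b] ![c, d]) ![e, f, g] = ![a, b, c, d, e, f, g] := by
    ext i
    fin_cases i <;> rfl
  rw [awedge_decForm, awedge_decForm]
  exact congrArg decForm h

theorem termsForm_curryLeft_stdVec (L : List (ℤ × Fin 8 × Fin 8 × Fin 8)) (i : Fin 8) :
    (termsForm L).curryLeft (stdVec i) = ((contractTermsAt L i).map fun t =>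
      (t.1 : ℝ) • decForm ![t.2.2.1, t.2.2.2]).sum := by
  rw [termsForm_curryLeft, contractTermsAt, ← list_sum_map_filter _ (fun t => t.2.1 = i)]
  · congr 1
    refine List.map_congr_left fun t ht => ?_
    have h : t.2.1 = i := by simpa using (List.mem_filter.1 ht).2
    simp [h]
  · intro t ht
    simp [ht]

theorem redMul_termsForm (L : List (ℤ × Fin 8 × Fin 8 × Fin 8)) (i j k : Fin 8) :
    125411328000 * redMul (termsForm L) (stdVec i) (stdVec j) k = (scaledConst L i j k : ℝ) := by
  rw [scaledConst, list_sum_map_filter (wedgeTerms L i j) (fun m => m.2.Nodup), redMul_apply,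
    termsForm_curryLeft_stdVec, termsForm_curryLeft_stdVec]
  · conv_lhs => enter [2, 2]; rw [termsForm]
    simp only [awedge_list_sum_left, awedge_smul_left]
    simp only [awedge_list_sum_right (p := 2) (q := 2), awedge_smul_right, awedge_list_sum_left,
      awedge_smul_left]
    simp only [awedge_list_sum_right, awedge_smul_right, awedge_awedge_decForm]
    simp only [altMap_list_sum_apply, AlternatingMap.smul_apply, smul_eq_mul,
      ← List.sum_map_mul_left, wedgeTerms, List.map_flatMap, Int.cast_list_sum, list_sum_flatMap,
      List.map_map, Function.comp_def]
    refine congrArg List.sum (List.map_congr_left fun s _ => congrArg List.sum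
      (List.map_congr_left fun t _ => congrArg List.sum (List.map_congr_left fun u _ => ?_)))
    have h := decForm_omitVec_eq_vandermondeProd k s.2.2.1 s.2.2.2 t.2.2.1 t.2.2.2 u.2.1 u.2.2.1
      u.2.2.2
    simp only [Int.cast_mul, ← h]
    ring
  · intro m hm
    rw [vandermondeProd_eq_zero_of_not_nodup, mul_zero]
    exact fun h => hm (List.nodup_cons.1 h).2

/-- A generic 3-form on `ℝ⁸`. -/
def genericForm : (Fin 8 → ℝ) [⋀^Fin 3]→ₗ[ℝ] ℝ := termsForm genericTerms

theorem redMul_genericForm (i j k : Fin 8) :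
    redMul genericForm (stdVec i) (stdVec j) k = structConst i j k := by
  rw [genericForm]
  have h := redMul_termsForm genericTerms i j k
  rw [scaledConst_genericTerms] at h
  push_cast at h
  exact mul_left_cancel₀ (by norm_num) h

theorem reducedTraceForm_eq_sum (mul : (Fin 8 → ℝ) →ₗ[ℝ] (Fin 8 → ℝ) →ₗ[ℝ] (Fin 8 → ℝ))
    (v w : Fin 8 → ℝ) :
    reducedTraceForm mul v w = ∑ a, ∑ b, mul v (stdVec b) a * mul w (stdVec a) b := by
  rw [reducedTraceForm, LinearMap.trace_eq_matrix_trace ℝ (Pi.basisFun ℝ (Fin 8)),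
    LinearMap.toMatrix_comp _ (Pi.basisFun ℝ (Fin 8)), Matrix.trace]
  simp [Matrix.mul_apply]

/-- The reduced trace form as a bilinear map. -/
def traceBilin (mul : (Fin 8 → ℝ) →ₗ[ℝ] (Fin 8 → ℝ) →ₗ[ℝ] (Fin 8 → ℝ)) :
    (Fin 8 → ℝ) →ₗ[ℝ] (Fin 8 → ℝ) →ₗ[ℝ] ℝ :=
  (LinearMap.compr₂ (LinearMap.mul ℝ (Module.End ℝ (Fin 8 → ℝ))) (LinearMap.trace ℝ _)).compl₁₂
    mul mul

theorem traceBilin_apply (mul : (Fin 8 → ℝ) →ₗ[ℝ] (Fin 8 → ℝ) →ₗ[ℝ] (Fin 8 → ℝ))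
    (v w : Fin 8 → ℝ) : traceBilin mul v w = reducedTraceForm mul v w :=
  rfl

theorem linearMap_apply_eq_of_stdVec {f g : (Fin 8 → ℝ) →ₗ[ℝ] ℝ}
    (h : ∀ i, f (stdVec i) = g (stdVec i)) (v : Fin 8 → ℝ) : f v = g v :=
  LinearMap.congr_fun ((Pi.basisFun ℝ (Fin 8)).ext fun i => by simpa using h i) v

theorem traceFormCompatible_iff {mul : (Fin 8 → ℝ) →ₗ[ℝ] (Fin 8 → ℝ) →ₗ[ℝ] (Fin 8 → ℝ)} :
    TraceFormCompatible mul ↔ ∀ i j l : Fin 8,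
      reducedTraceForm mul (mul (stdVec i) (stdVec j)) (stdVec l) =
        reducedTraceForm mul (stdVec i) (mul (stdVec j) (stdVec l)) := by
  refine ⟨fun h i j l => h _ _ _, fun h => ?_⟩
  simp only [← traceBilin_apply] at h
  have h1 (i j : Fin 8) (c : Fin 8 → ℝ) := linearMap_apply_eq_of_stdVec
    (f := traceBilin mul (mul (stdVec i) (stdVec j)))
    (g := traceBilin mul (stdVec i) ∘ₗ mul (stdVec j)) (h i j) c
  have h2 (i : Fin 8) (b c : Fin 8 → ℝ) := linearMap_apply_eq_of_stdVec
    (f := (traceBilin mul).flip c ∘ₗ mul (stdVec i))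
    (g := traceBilin mul (stdVec i) ∘ₗ mul.flip c) (fun j => h1 i j c) b
  exact fun a b c => linearMap_apply_eq_of_stdVec
    (f := (traceBilin mul).flip c ∘ₗ mul.flip b)
    (g := (traceBilin mul).flip (mul b c)) (fun i => h2 i b c) a

theorem traceFormCompatible_redMul_genericForm : TraceFormCompatible (redMul genericForm) := by
  have hB (i j : Fin 8) : reducedTraceForm (redMul genericForm) (stdVec i) (stdVec j) =
      traceConst i j := by
    rw [reducedTraceForm_eq_sum, ← sum_structConst_mul]
    simp [redMul_genericForm]
  have hmul (i j : Fin 8) : redMul genericForm (stdVec i) (stdVec j) =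
      ∑ k, (structConst i j k : ℝ) • stdVec k := by
    conv_lhs => rw [pi_eq_sum_univ' (redMul genericForm (stdVec i) (stdVec j))]
    simp [redMul_genericForm]
  refine traceFormCompatible_iff.2 fun i j l => ?_
  rw [hmul, hmul, ← traceBilin_apply, ← traceBilin_apply]
  simp only [map_sum, map_smul, LinearMap.sum_apply, LinearMap.smul_apply, traceBilin_apply, hB,
    smul_eq_mul]
  exact_mod_cast sum_structConst_mul_traceConst i j l

theorem genericForm_apply (x y z : Fin 8 → ℝ) :
    genericForm ![x, y, z] =
      (x 0 * (y 2 * z 5 - y 5 * z 2) - x 2 * (y 0 * z 5 - y 5 * z 0) +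
        x 5 * (y 0 * z 2 - y 2 * z 0)) +
      (x 1 * (y 3 * z 6 - y 6 * z 3) - x 3 * (y 1 * z 6 - y 6 * z 1) +
        x 6 * (y 1 * z 3 - y 3 * z 1)) -
      (x 0 * (y 4 * z 7 - y 7 * z 4) - x 4 * (y 0 * z 7 - y 7 * z 0) +
        x 7 * (y 0 * z 4 - y 4 * z 0)) -
      (x 1 * (y 4 * z 7 - y 7 * z 4) - x 4 * (y 1 * z 7 - y 7 * z 1) +
        x 7 * (y 1 * z 4 - y 4 * z 1)) +
      (x 2 * (y 3 * z 4 - y 4 * z 3) - x 3 * (y 2 * z 4 - y 4 * z 2) +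
        x 4 * (y 2 * z 3 - y 3 * z 2)) +
      (x 5 * (y 6 * z 7 - y 7 * z 6) - x 6 * (y 5 * z 7 - y 7 * z 5) +
        x 7 * (y 5 * z 6 - y 6 * z 5)) := by
  simp [genericForm, termsForm, genericTerms, decForm_apply, Matrix.det_fin_three]
  ring

/-- The images of the standard basis under an endomorphism `A` whose infinitesimal action on the
generic 3-form is the 3-form with coefficients `η`. -/
def infinitesimalLift (η : Fin 8 → Fin 8 → Fin 8 → ℝ) : Fin 8 → Fin 8 → ℝ :=
  ![
    ![1/3 * η 0 2 5 - 2/3 * η 0 3 6 - 2/3 * η 0 4 7 + 1/3 * η 1 2 5 + 1/3 * η 1 3 6 + 1/3 *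
      η 1 4 7 - 1/3 * η 2 3 4 - 1/3 * η 5 6 7, η 0 3 6, η 0 3 4, -η 0 1 6, η 0 1 7, η 0 6 7,
      η 0 1 3, -η 0 1 4],
    ![η 1 2 5, 1/3 * η 0 2 5 + 1/3 * η 0 3 6 + 1/3 * η 0 4 7 - 2/3 * η 1 2 5 + 1/3 * η 1 3 6
      - 2/3 * η 1 4 7 - 1/3 * η 2 3 4 - 1/3 * η 5 6 7, η 0 1 5, -η 1 2 4, 0, -η 0 1 2,
      -η 1 5 7, 0],
    ![η 0 1 2 + η 1 6 7 - η 2 3 6 - η 2 4 7, η 2 3 6, 2/3 * η 0 2 5 + 2/3 * η 0 3 6 + 2/3 *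
      η 0 4 7 - 1/3 * η 1 2 5 - 1/3 * η 1 3 6 - 1/3 * η 1 4 7 + 1/3 * η 2 3 4 - 2/3 *
      η 5 6 7, η 1 2 6, -η 1 2 7, η 2 6 7, -η 1 2 3, 0],
    ![-η 2 3 5, -η 0 1 3 - η 0 5 7 + η 2 3 5 - η 3 4 7, η 0 3 5, -1/3 * η 0 2 5 - 1/3 *
      η 0 3 6 - 1/3 * η 0 4 7 + 2/3 * η 1 2 5 + 2/3 * η 1 3 6 + 2/3 * η 1 4 7 + 1/3 *
      η 2 3 4 + 1/3 * η 5 6 7, -η 0 3 7, -η 0 1 7 + η 0 2 3, -η 3 5 7, 0],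
    ![-η 1 5 6 - η 2 4 5, -η 0 1 4 - η 0 5 6 - η 3 4 6, η 0 4 5 - η 1 4 5, -η 0 4 6 +
      η 1 4 6, -1/3 * η 0 2 5 - 1/3 * η 0 3 6 - 1/3 * η 0 4 7 - 1/3 * η 1 2 5 - 1/3 *
      η 1 3 6 - 1/3 * η 1 4 7 + 1/3 * η 2 3 4 + 1/3 * η 5 6 7, -η 0 1 6 + η 0 2 4, -η 0 1 5
      + η 1 3 4, η 4 5 6],
    ![-η 0 1 5 + η 1 3 4 + η 3 5 6 + η 4 5 7, -η 3 5 6, η 3 4 5, η 1 5 6, 0, η 5 6 7,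
      η 1 3 5, -η 1 4 5],
    ![η 2 5 6, η 0 1 6 - η 0 2 4 - η 2 5 6 + η 4 6 7, -η 0 1 4 - η 0 5 6, -η 2 4 6, 0,
      η 0 2 6, 0, -η 0 4 6],
    ![-η 1 2 3 + η 2 5 7, η 0 1 7 - η 0 2 3 + η 3 6 7, -η 0 1 3 - η 0 5 7, -η 0 1 2 -
      η 1 6 7, η 2 3 7, η 0 2 7 - η 1 2 7, -η 0 3 7 + η 1 3 7, 0]]

/-- The increasing triples in `Fin 8`. -/
def incTriples : List (Fin 8 × Fin 8 × Fin 8) :=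
  [(0, 1, 2), (0, 1, 3), (0, 1, 4), (0, 1, 5), (0, 1, 6), (0, 1, 7), (0, 2, 3), (0, 2, 4),
   (0, 2, 5), (0, 2, 6), (0, 2, 7), (0, 3, 4), (0, 3, 5), (0, 3, 6), (0, 3, 7), (0, 4, 5),
   (0, 4, 6), (0, 4, 7), (0, 5, 6), (0, 5, 7), (0, 6, 7), (1, 2, 3), (1, 2, 4), (1, 2, 5),
   (1, 2, 6), (1, 2, 7), (1, 3, 4), (1, 3, 5), (1, 3, 6), (1, 3, 7), (1, 4, 5), (1, 4, 6),
   (1, 4, 7), (1, 5, 6), (1, 5, 7), (1, 6, 7), (2, 3, 4), (2, 3, 5), (2, 3, 6), (2, 3, 7),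
   (2, 4, 5), (2, 4, 6), (2, 4, 7), (2, 5, 6), (2, 5, 7), (2, 6, 7), (3, 4, 5), (3, 4, 6),
   (3, 4, 7), (3, 5, 6), (3, 5, 7), (3, 6, 7), (4, 5, 6), (4, 5, 7), (4, 6, 7), (5, 6, 7)]

theorem mem_incTriples : ∀ i j k : Fin 8, i < j → j < k → (i, j, k) ∈ incTriples := by
  decide +kernel

set_option maxHeartbeats 4000000 in
theorem genericForm_infinitesimalLift (η : Fin 8 → Fin 8 → Fin 8 → ℝ) :
    ∀ t ∈ incTriples, genericForm ![infinitesimalLift η t.1, stdVec t.2.1, stdVec t.2.2] +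
      genericForm ![stdVec t.1, infinitesimalLift η t.2.1, stdVec t.2.2] +
      genericForm ![stdVec t.1, stdVec t.2.1, infinitesimalLift η t.2.2] =
        η t.1 t.2.1 t.2.2 := by
  simp only [incTriples, List.forall_mem_cons, genericForm_apply]
  refine ⟨?_, ?_, ?_, ?_, ?_, ?_, ?_, ?_, ?_, ?_, ?_, ?_, ?_, ?_, ?_, ?_, ?_, ?_, ?_, ?_, ?_, ?_,
    ?_, ?_, ?_, ?_, ?_, ?_, ?_, ?_, ?_, ?_, ?_, ?_, ?_, ?_, ?_, ?_, ?_, ?_, ?_, ?_, ?_, ?_, ?_,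
    ?_, ?_, ?_, ?_, ?_, ?_, ?_, ?_, ?_, ?_, ?_, List.forall_mem_nil _⟩
  all_goals
    simp [infinitesimalLift]
    try ring

theorem threeForm_ext {η η' : (Fin 8 → ℝ) [⋀^Fin 3]→ₗ[ℝ] ℝ}
    (h : ∀ t ∈ incTriples, η ![stdVec t.1, stdVec t.2.1, stdVec t.2.2] =
      η' ![stdVec t.1, stdVec t.2.1, stdVec t.2.2]) : η = η' := by
  refine Module.Basis.ext_alternating (Pi.basisFun ℝ (Fin 8)) fun v hv => ?_
  have hmono : StrictMono (v ∘ Tuple.sort v) :=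
    (Tuple.monotone_sort v).strictMono_of_injective (hv.comp (Tuple.sort v).injective)
  have hv' : (fun a => Pi.basisFun ℝ (Fin 8) (v a)) =
      ![stdVec ((v ∘ Tuple.sort v) 0), stdVec ((v ∘ Tuple.sort v) 1),
        stdVec ((v ∘ Tuple.sort v) 2)] ∘ ((Tuple.sort v).symm : Equiv.Perm (Fin 3)) := by
    rw [Equiv.eq_comp_symm]
    funext a
    fin_cases a <;> simp
  rw [hv', AlternatingMap.map_perm, AlternatingMap.map_perm,
    h _ (mem_incTriples _ _ _ (hmono (by decide)) (hmono (by decide)))]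

/-- The trilinear map underlying the generic 3-form, as a continuous multilinear map. -/
def genericFormCLM : ContinuousMultilinearMap ℝ (fun _ : Fin 3 => Fin 8 → ℝ) ℝ where
  toMultilinearMap := genericForm.toMultilinearMap
  cont := by
    have h : ∀ v : Fin 3 → Fin 8 → ℝ, genericForm.toMultilinearMap v =
        genericForm ![v 0, v 1, v 2] := fun v =>
      congrArg genericForm (funext fun i => by fin_cases i <;> rfl)
    change Continuous fun v => genericForm.toMultilinearMap v
    simp only [h, genericForm_apply]
    fun_prop

theorem genericFormCLM_apply (v : Fin 3 → Fin 8 → ℝ) : genericFormCLM v = genericForm v :=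
  rfl

/-- The coefficients of the pullback of the generic 3-form by the endomorphism mapping the
standard basis to `A`. -/
def genericPullback (A : Fin 8 → Fin 8 → ℝ) (t : {t // t ∈ incTriples}) : ℝ :=
  genericFormCLM ![A t.1.1, A t.1.2.1, A t.1.2.2]

theorem map_nhds_genericPullback :
    Filter.map genericPullback (nhds stdVec) = nhds (genericPullback stdVec) := by
  let E (t : {t // t ∈ incTriples}) : (Fin 8 → Fin 8 → ℝ) →L[ℝ] (Fin 3 → Fin 8 → ℝ) :=
    ContinuousLinearMap.pi fun i => ContinuousLinearMap.proj (![t.1.1, t.1.2.1, t.1.2.2] i)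
  have hE (A : Fin 8 → Fin 8 → ℝ) (t : {t // t ∈ incTriples}) :
      E t A = ![A t.1.1, A t.1.2.1, A t.1.2.2] := by
    ext i
    fin_cases i <;> rfl
  have hd : HasStrictFDerivAt genericPullback
      (ContinuousLinearMap.pi fun t => (genericFormCLM.linearDeriv (E t stdVec)).comp (E t))
      stdVec := by
    rw [hasStrictFDerivAt_pi']
    intro t
    have := (genericFormCLM.hasStrictFDerivAt (E t stdVec)).comp stdVec (E t).hasStrictFDerivAt
    convert! this using 1
  refine hd.map_nhds_eq_of_surj (LinearMap.range_eq_top.2 fun c => ?_)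
  let η (i j k : Fin 8) : ℝ := if h : (i, j, k) ∈ incTriples then c ⟨(i, j, k), h⟩ else 0
  refine ⟨infinitesimalLift η, funext fun t => ?_⟩
  have key := genericForm_infinitesimalLift η t.1 t.2
  have hη : η t.1.1 t.1.2.1 t.1.2.2 = c t := dif_pos t.2
  rw [hη] at key
  rw [← key]
  have h0 (a b c x : Fin 8 → ℝ) : Function.update ![a, b, c] 0 x = ![x, b, c] := by
    ext1 i; fin_cases i <;> rfl
  have h1 (a b c x : Fin 8 → ℝ) : Function.update ![a, b, c] 1 x = ![a, x, c] := by
    ext1 i; fin_cases i <;> rfl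
  have h2 (a b c x : Fin 8 → ℝ) : Function.update ![a, b, c] 2 x = ![a, b, x] := by
    ext1 i; fin_cases i <;> rfl
  simp [ContinuousMultilinearMap.linearDeriv_apply, hE, Fin.sum_univ_three, genericFormCLM_apply,
    h0, h1, h2]

theorem eventually_traceFormCompatible (η : (Fin 8 → ℝ) [⋀^Fin 3]→ₗ[ℝ] ℝ) :
    ∀ᶠ r : ℝ in nhds 0, TraceFormCompatible (redMul (genericForm + r • η)) := by
  have hdet : ∀ᶠ A : Fin 8 → Fin 8 → ℝ in nhds stdVec, (Matrix.of A).det ≠ 0 := by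
    refine ContinuousAt.eventually_ne (Continuous.continuousAt (by fun_prop)) ?_
    convert! one_ne_zero (α := ℝ)
    convert! Matrix.det_one (n := Fin 8) (R := ℝ)
    ext i j
    simp [Matrix.one_apply, Pi.single_apply, eq_comm]
  have hpull := Filter.image_mem_map (m := genericPullback) hdet
  rw [map_nhds_genericPullback] at hpull
  have hc : Filter.Tendsto (fun (r : ℝ) (t : {t // t ∈ incTriples}) => genericPullback stdVec t +
      r * η ![stdVec t.1.1, stdVec t.1.2.1, stdVec t.1.2.2]) (nhds 0)
      (nhds (genericPullback stdVec)) := by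
    refine Continuous.tendsto' (by fun_prop) _ _ ?_
    simp
  filter_upwards [hc hpull] with r ⟨A, hA, hr⟩
  have hg : LinearMap.det (Matrix.toLin' (Matrix.of A).transpose) ≠ 0 := by
    rwa [LinearMap.det_toLin', Matrix.det_transpose]
  let g := LinearMap.equivOfDetNeZero _ hg
  have hgA (i : Fin 8) : g.toLinearMap (stdVec i) = A i := by
    change Matrix.toLin' (Matrix.of A).transpose (stdVec i) = A i
    simp
  have hω : genericForm + r • η = genericForm.compLinearMap g.toLinearMap := by
    refine threeForm_ext fun t ht => ?_
    have h := congrFun hr ⟨t, ht⟩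
    have hcomp : g.toLinearMap ∘ ![stdVec t.1, stdVec t.2.1, stdVec t.2.2] =
        ![A t.1, A t.2.1, A t.2.2] := by
      ext1 i
      fin_cases i <;> exact hgA _
    rw [AlternatingMap.compLinearMap_apply]
    simp only [genericPullback, genericFormCLM_apply] at h
    refine h.symm.trans ?_
    rw [← hcomp]
    rfl
  rw [hω, ← isReducedMul_iff_eq_redMul.1
    ((isReducedMul_iff_eq_redMul.2 rfl).compLinearMap g)]
  exact traceFormCompatible_redMul_genericForm.conj _ _

theorem analyticAt_redMul_add_smul (ω η : (Fin 8 → ℝ) [⋀^Fin 3]→ₗ[ℝ] ℝ) (v w : Fin 8 → ℝ)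
    (k : Fin 8) (r₀ : ℝ) : AnalyticAt ℝ (fun r : ℝ => redMul (ω + r • η) v w k) r₀ := by
  simp only [redMul_apply, AlternatingMap.curryLeft_add, AlternatingMap.curryLeft_smul,
    LinearMap.add_apply, LinearMap.smul_apply, awedge_add_left, awedge_add_right,
    awedge_smul_left, awedge_smul_right, AlternatingMap.add_apply, AlternatingMap.smul_apply,
    smul_add, smul_eq_mul]
  fun_prop

theorem linearMap_apply_eq_sum_stdVec
    (mul : (Fin 8 → ℝ) →ₗ[ℝ] (Fin 8 → ℝ) →ₗ[ℝ] (Fin 8 → ℝ)) (u w : Fin 8 → ℝ) (k : Fin 8) :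
    mul u w k = ∑ l, u l * mul (stdVec l) w k := by
  conv_lhs => rw [← (Pi.basisFun ℝ (Fin 8)).sum_repr u, map_sum]
  simp [LinearMap.sum_apply]

theorem analyticAt_redMul_add_smul_left (ω η : (Fin 8 → ℝ) [⋀^Fin 3]→ₗ[ℝ] ℝ)
    {u : ℝ → Fin 8 → ℝ} {r₀ : ℝ} (hu : ∀ l, AnalyticAt ℝ (fun r => u r l) r₀) (w : Fin 8 → ℝ)
    (k : Fin 8) : AnalyticAt ℝ (fun r : ℝ => redMul (ω + r • η) (u r) w k) r₀ := by
  have h (l : Fin 8) := analyticAt_redMul_add_smul ω η (stdVec l) w k r₀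
  simp only [linearMap_apply_eq_sum_stdVec (redMul _) (u _)]
  fun_prop

theorem traceFormCompatible_redMul (ω : (Fin 8 → ℝ) [⋀^Fin 3]→ₗ[ℝ] ℝ) :
    TraceFormCompatible (redMul ω) := by
  have hev := eventually_traceFormCompatible (ω - genericForm)
  have hω : ω = genericForm + (1 : ℝ) • (ω - genericForm) := by simp
  generalize ω - genericForm = η at hev hω
  rw [hω]
  intro a b c
  have hM (v w : Fin 8 → ℝ) (k : Fin 8) (r₀ : ℝ) :=
    analyticAt_redMul_add_smul genericForm η v w k r₀
  have hMM (v w x : Fin 8 → ℝ) (k : Fin 8) (r₀ : ℝ) :=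
    analyticAt_redMul_add_smul_left genericForm η (fun l => hM v w l r₀) x k
  have hL : AnalyticOnNhd ℝ (fun r : ℝ => reducedTraceForm (redMul (genericForm + r • η))
      (redMul (genericForm + r • η) a b) c) Set.univ := fun r _ => by
    simp only [reducedTraceForm_eq_sum]
    fun_prop
  have hR : AnalyticOnNhd ℝ (fun r : ℝ => reducedTraceForm (redMul (genericForm + r • η))
      a (redMul (genericForm + r • η) b c)) Set.univ := fun r _ => by
    simp only [reducedTraceForm_eq_sum]
    fun_prop
  exact congrFun (hL.eq_of_eventuallyEq hR (hev.mono fun r hr => hr a b c)) 1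

theorem reducedTraceForm_compatible (ω : (Fin 8 → ℝ) [⋀^Fin 3]→ₗ[ℝ] ℝ)
    (mul : (Fin 8 → ℝ) →ₗ[ℝ] (Fin 8 → ℝ) →ₗ[ℝ] (Fin 8 → ℝ)) (hmul : IsReducedMul ω mul) :
    ∀ a b c : Fin 8 → ℝ,
      reducedTraceForm mul (mul a b) c = reducedTraceForm mul a (mul b c) := by
  rw [isReducedMul_iff_eq_redMul.1 hmul]
  exact traceFormCompatible_redMul ω
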